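/- Let G and H be modules over Z_p (the integers localized at a prime p) such that G has a partial decomposition basis and G ≅_p H (they are partially isomorphic). Then H has a partial decomposition basis, and for every equivalence class e of Ulm sequences, ŵ(e,H) = ŵ(e,G). -/

import Mathlib

noncomputable section

namespace UlmW

universe u

variable {R : Type*} [CommRing R]

/-- The submodule `p^α M`, defined by transfinite recursion on `α`. -/
def ppow {M : Type u} [AddCommGroup M] [Module R M] (p : R) (α : Ordinal.{u}) :
    Submodule R M :=
  Ordinal.limitRecOn α ⊤ (fun _ S => Submodule.map (LinearMap.lsmul R M p) S)
    fun β _ ih => ⨅ (γ : Set.Iio β), ih γ.1 γ.2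

open scoped Classical in
/-- The `p`-height of `x`, with `⊤` playing the role of `∞`. -/
def pheight {M : Type u} [AddCommGroup M] [Module R M] (p : R) (x : M) :
    WithTop Ordinal.{u} :=
  if h : ∃ α : Ordinal.{u}, x ∈ ppow p α ∧ x ∉ ppow p (α + 1) then (h.choose : WithTop Ordinal)
  else ⊤

/-- `H⁰ = {x : ∃ a ≠ 0, a • x ∈ H}`. -/
def hull {M : Type u} [AddCommGroup M] [Module R M] (H : Submodule R M) : Set M :=
  {x | ∃ a : R, a ≠ 0 ∧ a • x ∈ H}

/-- `X` is a decomposition set with respect to the single prime `p`. -/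
def IsDecompWrt {M : Type u} [AddCommGroup M] [Module R M] (p : R) (X : Set M) : Prop :=
  (LinearIndependent R (fun x : X => (x : M))) ∧
  (∀ x ∈ X, ∀ a : R, a ≠ 0 → a • x ≠ 0) ∧
  (∀ s : Finset M, ↑s ⊆ X → ∀ c : M → R,
    pheight p (∑ x ∈ s, c x • x) = s.inf fun x => pheight p (c x • x))

/-- `X` is a decomposition set (with respect to every prime of `R`). -/
def IsDecompositionSet (R : Type*) [CommRing R] {M : Type u} [AddCommGroup M] [Module R M]
    (X : Set M) : Prop :=
  ∀ p : R, Prime p → IsDecompWrt p X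

/-- partial decomposition basis, heights taken w.r.t. a fixed prime `p`. -/
def IsPDBWrt {M : Type u} [AddCommGroup M] [Module R M] (p : R) (C : Set (Set M)) : Prop :=
  C.Nonempty ∧ (∀ X ∈ C, X.Finite) ∧ (∀ X ∈ C, IsDecompWrt p X) ∧
  ∀ X ∈ C, ∀ x : M, ∃ Y ∈ C, X ⊆ Y ∧ x ∈ hull (Submodule.span R Y)

/-- partial decomposition basis (heights w.r.t. all primes of `R`). -/
def IsPDB (R : Type*) [CommRing R] {M : Type u} [AddCommGroup M] [Module R M] (C : Set (Set M)) : Prop :=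
  C.Nonempty ∧ (∀ X ∈ C, X.Finite) ∧ (∀ X ∈ C, IsDecompositionSet R X) ∧
  ∀ X ∈ C, ∀ x : M, ∃ Y ∈ C, X ⊆ Y ∧ x ∈ hull (Submodule.span R Y)

/-- A partial isomorphism system `I : G ≅_p H`. -/
def IsPartialIsoSystem {M N : Type*} [AddCommGroup M] [Module R M]
    [AddCommGroup N] [Module R N] (I : Set (M →ₗ.[R] N)) : Prop :=
  I.Nonempty ∧
  (∀ f ∈ I, Function.Injective f.toFun) ∧
  (∀ f ∈ I, ∀ a : M, ∃ g ∈ I, f ≤ g ∧ a ∈ g.domain) ∧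
  (∀ f ∈ I, ∀ b : N, ∃ g ∈ I, f ≤ g ∧ ∃ y : g.domain, g y = b)

/-- The Ulm sequence of `x`: `U(x) = (|pⁱ x|)ᵢ`. -/
def UlmSeqOf {M : Type u} [AddCommGroup M] [Module R M] (p : R) (x : M) :
    ℕ → WithTop Ordinal.{u} :=
  fun i => pheight p ((p ^ i) • x)

/-- `u` is an Ulm sequence. -/
def IsUlmSeq (u : ℕ → WithTop Ordinal.{u}) : Prop :=
  ∀ i, (u i = ⊤ → u (i + 1) = ⊤) ∧ (u i ≠ ⊤ → u i < u (i + 1))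

/-- Equivalence of Ulm sequences. -/
def UlmEquiv (u v : ℕ → WithTop Ordinal.{u}) : Prop :=
  ∃ m n : ℕ, ∀ i, u (i + n) = v (i + m)

/-- `X` contains at least `n` elements whose Ulm sequence is equivalent to `u`. -/
def HasAtLeast {M : Type u} [AddCommGroup M] [Module R M] (p : R)
    (u : ℕ → WithTop Ordinal.{u}) (n : ℕ) (X : Set M) : Prop :=
  ∃ s : Finset M, ↑s ⊆ X ∧ n ≤ s.card ∧ ∀ x ∈ s, UlmEquiv (UlmSeqOf p x) u

/-- `ŵ_C(e,G)` where `e` is the class of the Ulm sequence `u`. -/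
def wHat {M : Type u} [AddCommGroup M] [Module R M] (p : R) (C : Set (Set M))
    (u : ℕ → WithTop Ordinal.{u}) : ℕ∞ :=
  sSup {N : ℕ∞ | ∃ n : ℕ, N = (n : ℕ∞) ∧ ∃ X ∈ C, HasAtLeast p u n X}

/-- `x` is proper with respect to `S`. -/
def IsProper {M : Type u} [AddCommGroup M] [Module R M] (p : R) (S : Submodule R M)
    (x : M) : Prop :=
  ∀ s ∈ S, pheight p (x + s) ≤ pheight p x

/-- `H` is a nice submodule. -/
def IsNice {M : Type u} [AddCommGroup M] [Module R M] (p : R) (H : Submodule R M) : Prop :=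
  ∀ x : M, ∃ h ∈ H, ∀ h' ∈ H, pheight p (x + h') ≤ pheight p (x + h)

/-- The Ulm invariant `u_p(σ, M)`: the dimension of `(p^σ M)[p]/(p^{σ+1} M)[p]`
over the residue field `R/(p)`. -/
def uCard (p : R) (M : Type u) [AddCommGroup M] [Module R M] (σ : Ordinal.{u}) :
    Cardinal :=
  let V : Submodule R M := ppow p σ ⊓ Submodule.torsionBy R M p
  let W : Submodule R V := (ppow p (σ + 1) ⊓ Submodule.torsionBy R M p).comap V.subtype
  Module.rank (R ⧸ Ideal.span {p})
    ((V ⧸ W) ⧸ (Ideal.span {p} • (⊤ : Submodule R (V ⧸ W))))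

/-- `û_p(σ, M) = min (u_p(σ, M), ω)`. -/
def uHat (p : R) (M : Type u) [AddCommGroup M] [Module R M] (σ : Ordinal.{u}) : Cardinal :=
  min (uCard p M σ) Cardinal.aleph0

/-- `û_p(∞, M) = min (dim (p^∞ M)[p], ω)`. -/
def uHatInf (p : R) (M : Type u) [AddCommGroup M] [Module R M] : Cardinal :=
  let V : Submodule R M := (⨅ α : Ordinal.{u}, ppow p α) ⊓ Submodule.torsionBy R M p
  min (Module.rank (R ⧸ Ideal.span {p})
    (V ⧸ (Ideal.span {p} • (⊤ : Submodule R V)))) Cardinal.aleph0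

end UlmW

open UlmW

/-- The ideal `(p) ⊆ ℤ` is prime. -/
instance zpSpanPrime (p : ℤ) [hp : Fact (Prime p)] : (Ideal.span {p} : Ideal ℤ).IsPrime :=
  (Ideal.span_singleton_prime hp.out.ne_zero).mpr hp.out

/-- `ℤ_(p)`, the integers localized at the prime `p`. -/
abbrev Zp (p : ℤ) [Fact (Prime p)] : Type :=
  Localization.AtPrime (Ideal.span {p} : Ideal ℤ)


universe u

open UlmW

namespace UlmW

section Heights

variable {R : Type*} [CommRing R] {M N : Type u} [AddCommGroup M] [Module R M]
  [AddCommGroup N] [Module R N] {p : R}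

theorem ppow_zero : ppow (M := M) p 0 = ⊤ :=
  Ordinal.limitRecOn_zero ..

theorem mem_ppow_add_one {α : Ordinal.{u}} {x : M} :
    x ∈ ppow p (α + 1) ↔ ∃ y ∈ ppow p α, p • y = x := by
  have h : ppow (M := M) p (α + 1) = (ppow p α).map (LinearMap.lsmul R M p) :=
    Ordinal.limitRecOn_add_one ..
  simp [h]

theorem mem_ppow_of_isSuccLimit {α : Ordinal.{u}} (hα : Order.IsSuccLimit α) {x : M} :
    x ∈ ppow p α ↔ ∀ β < α, x ∈ ppow p β := by
  have h : ppow (M := M) p α = ⨅ γ : Set.Iio α, ppow p γ.1 :=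
    Ordinal.limitRecOn_limit _ _ _ _ hα
  simp [h]

theorem pheight_congr {x : M} {y : N}
    (h : ∀ α : Ordinal.{u}, x ∈ ppow p α ↔ y ∈ ppow p α) : pheight p x = pheight p y := by
  have hP : (fun α : Ordinal.{u} => x ∈ ppow p α ∧ x ∉ ppow p (α + 1)) =
      fun α => y ∈ ppow p α ∧ y ∉ ppow p (α + 1) := by
    funext α
    rw [h, h]
  classical
  exact congrArg (fun P : Ordinal.{u} → Prop =>
    if h : ∃ α, P α then (h.choose : WithTop Ordinal.{u}) else ⊤) hP

theorem pheight_smul_of_isUnit {c : R} (hc : IsUnit c) (x : M) :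
    pheight p (c • x) = pheight p x :=
  pheight_congr fun α => by
    obtain ⟨c, rfl⟩ := hc
    exact (ppow p α).smul_mem_iff' c

theorem pheight_mul_smul_of_isUnit {c : R} (hc : IsUnit c) (d : R) (x : M) :
    pheight p ((d * c) • x) = pheight p (d • x) := by
  rw [mul_comm, mul_smul, pheight_smul_of_isUnit hc]

theorem IsUlmSeq.monotone {u : ℕ → WithTop Ordinal.{u}} (hu : IsUlmSeq u) : Monotone u := by
  refine monotone_nat_of_le_succ fun i => ?_
  by_cases h : u i = ⊤
  · rw [(hu i).1 h]; exact le_top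
  · exact ((hu i).2 h).le

end Heights

section Hull

variable {R : Type*} [CommRing R] {M : Type u} [AddCommGroup M] [Module R M] {p : R}

theorem hull_mono {S T : Submodule R M} (h : S ≤ T) : hull S ⊆ hull T :=
  fun _ ⟨a, ha, hx⟩ => ⟨a, ha, h hx⟩

theorem IsPDBWrt.exists_subset_hull {C : Set (Set M)} (hC : IsPDBWrt p C) {X : Set M}
    (hX : X ∈ C) {F : Set M} (hF : F.Finite) :
    ∃ Y ∈ C, X ⊆ Y ∧ F ⊆ hull (Submodule.span R Y) := by
  induction F, hF using Set.Finite.induction_on with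
  | empty => exact ⟨X, hX, subset_rfl, Set.empty_subset _⟩
  | @insert a F _ _ ih =>
    obtain ⟨Y, hY, hXY, hFY⟩ := ih
    obtain ⟨Z, hZ, hYZ, haZ⟩ := hC.2.2.2 Y hY a
    exact ⟨Z, hZ, hXY.trans hYZ,
      Set.insert_subset haZ (hFY.trans (hull_mono (Submodule.span_mono hYZ)))⟩

theorem exists_pow_smul_mem_of_subset_hull [IsDomain R] [IsDiscreteValuationRing R]
    (hp : Irreducible p) {S : Submodule R M} {F : Set M} (hF : F.Finite) (hFS : F ⊆ hull S) :
    ∃ k : ℕ, ∀ x ∈ F, p ^ k • x ∈ S := by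
  induction F, hF using Set.Finite.induction_on with
  | empty => exact ⟨0, by simp⟩
  | @insert a F _ _ ih =>
    obtain ⟨k, hk⟩ := ih ((Set.subset_insert _ _).trans hFS)
    obtain ⟨c, hc, hca⟩ := hFS (Set.mem_insert a F)
    obtain ⟨n, v, hv⟩ := IsDiscreteValuationRing.associated_pow_irreducible hc hp
    refine ⟨k + n, ?_⟩
    rintro x (rfl | hx)
    · rw [pow_add, ← hv, mul_comm c, ← mul_assoc, mul_smul]
      exact S.smul_mem _ hca
    · rw [add_comm, pow_add, mul_smul]
      exact S.smul_mem _ (hk x hx)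

end Hull

section Invariance

variable {R : Type*} [CommRing R] {p : R}

theorem det_one_sub_smul_ne_zero (hp : ¬ IsUnit p) {n : Type*} [Fintype n] [DecidableEq n]
    (E : Matrix n n R) : (1 - p • E).det ≠ 0 := by
  intro h
  let q := Ideal.Quotient.mk (Ideal.span {p})
  have hq : q p = 0 := Ideal.Quotient.eq_zero_iff_mem.2 (Ideal.mem_span_singleton_self p)
  have h1 : q.mapMatrix (1 - p • E) = 1 := by
    ext i j
    by_cases hij : i = j <;> simp [Matrix.one_apply, hij, hq]
  have h2 := q.map_det (1 - p • E)
  rw [h1, h, map_zero, Matrix.det_one] at h2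
  have : (1 : R) ∈ Ideal.span {p} := by
    rw [← Ideal.Quotient.eq_zero_iff_mem, map_one]; exact h2.symm
  exact hp (isUnit_of_dvd_one (Ideal.mem_span_singleton.1 this))

theorem card_le_of_det_mul_ne_zero [IsDomain R] {m n : Type*} [Fintype m] [DecidableEq m]
    [Fintype n] (A : Matrix m n R) (B : Matrix n m R) (h : (A * B).det ≠ 0) :
    Fintype.card m ≤ Fintype.card n := by
  have hA : LinearIndependent R A.row := by
    rw [Fintype.linearIndependent_iff]
    intro g hg
    have hgA : Matrix.vecMul g A = 0 := by
      rw [← hg]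
      ext j
      simp [Matrix.vecMul, dotProduct]
    have := Matrix.eq_zero_of_vecMul_eq_zero h (v := g) (by
      rw [← Matrix.vecMul_vecMul, hgA, Matrix.zero_vecMul])
    exact fun i => congrFun this i
  simpa using hA.fintype_card_le_finrank

variable {M : Type u} [AddCommGroup M] [Module R M]

theorem IsDecompWrt.pheight_sum_le {X : Set M} (hX : IsDecompWrt p X) {s : Finset M}
    (hs : ↑s ⊆ X) (c : M → R) {x : M} (hx : x ∈ s) :
    pheight p (∑ x ∈ s, c x • x) ≤ pheight p (c x • x) := by
  rw [hX.2.2 s hs c]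
  exact Finset.inf_le hx

theorem IsDecompWrt.pheight_pow_smul_sum_le {X : Set M} (hX : IsDecompWrt p X) {s : Finset M}
    (hs : ↑s ⊆ X) (c : M → R) {x : M} (hx : x ∈ s) (i : ℕ) :
    pheight p (p ^ i • ∑ x ∈ s, c x • x) ≤ pheight p ((p ^ i * c x) • x) := by
  simp only [Finset.smul_sum, ← mul_smul]
  exact hX.pheight_sum_le hs (fun x => p ^ i * c x) hx

/-- Finitely many elements with equivalent Ulm sequences have multiples with a common one. -/
theorem exists_common_tail {e : ℕ → WithTop Ordinal.{u}} {s : Finset M}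
    (hs : ∀ x ∈ s, UlmEquiv (UlmSeqOf p x) e) :
    ∃ (N : ℕ) (t : M → ℕ), ∀ x ∈ s, ∀ i, pheight p (p ^ (i + t x) • x) = e (i + N) := by
  have hs' : ∀ x, ∃ m n : ℕ, x ∈ s → ∀ i, pheight p (p ^ (i + n) • x) = e (i + m) := by
    intro x
    by_cases hx : x ∈ s
    · obtain ⟨m, n, h⟩ := hs x hx
      exact ⟨m, n, fun _ => h⟩
    · exact ⟨0, 0, fun h => absurd h hx⟩
  choose m n h using hs'
  refine ⟨s.sup m, fun x => s.sup m - m x + n x, fun x hx i => ?_⟩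
  have hm : m x ≤ s.sup m := Finset.le_sup hx
  rw [← add_assoc, h x hx]
  congr 1
  omega

variable [IsDomain R] [IsDiscreteValuationRing R]

theorem pow_dvd_mul_of_not_ulmEquiv (hp : Irreducible p) {e : ℕ → WithTop Ordinal.{u}}
    (he : IsUlmSeq e) {x x' y : M} {a b : R} {N t t' k l : ℕ}
    (hx : ∀ i, pheight p (p ^ (i + t) • x) = e (i + N))
    (hx' : ∀ i, pheight p (p ^ (i + t') • x') = e (i + N))
    (hxy : ∀ i, pheight p (p ^ (i + k + t) • x) ≤ pheight p ((p ^ i * a) • y))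
    (hyx : ∀ i, pheight p (p ^ (i + l) • y) ≤ pheight p ((p ^ i * b) • x'))
    (hy : ¬ UlmEquiv (UlmSeqOf p y) e) : p ^ (k + l + t' + 1) ∣ a * b := by
  rcases eq_or_ne a 0 with rfl | ha
  · simp
  rcases eq_or_ne b 0 with rfl | hb
  · simp
  obtain ⟨α, v, rfl⟩ := IsDiscreteValuationRing.eq_unit_mul_pow_irreducible ha hp
  obtain ⟨β, w, rfl⟩ := IsDiscreteValuationRing.eq_unit_mul_pow_irreducible hb hp
  have hdvd : p ^ (α + β) ∣ ↑v * p ^ α * (↑w * p ^ β) := ⟨v * w, by ring⟩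
  refine (pow_dvd_pow p ?_).trans hdvd
  by_contra! hlt
  refine hy ⟨t' + k + l + N, t' + l + α, fun i => le_antisymm ?_ ?_⟩
  · have h := hyx (i + t' + α)
    rw [mul_comm (w : R), ← mul_assoc, pheight_mul_smul_of_isUnit w.isUnit, ← pow_add,
      show i + t' + α + β = i + α + β + t' by ring, hx'] at h
    refine le_trans (le_of_eq ?_) (h.trans (he.monotone (by omega)))
    simp only [UlmSeqOf]
    congr 3; ring
  · have h := hxy (i + t' + l)
    rw [hx, mul_comm (v : R), ← mul_assoc, pheight_mul_smul_of_isUnit v.isUnit, ← pow_add] at h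
    refine le_trans (he.monotone (by omega)) (h.trans (le_of_eq ?_))
    simp only [UlmSeqOf]
    congr 3; ring

theorem HasAtLeast.exists_of_isPDBWrt (hp : Irreducible p) {C D : Set (Set M)}
    (hC : IsPDBWrt p C) (hD : IsPDBWrt p D) {e : ℕ → WithTop Ordinal.{u}} (he : IsUlmSeq e)
    {n : ℕ} {X : Set M} (hX : X ∈ C) (h : HasAtLeast p e n X) :
    ∃ Y ∈ D, HasAtLeast p e n Y := by
  classical
  obtain ⟨s, hsX, hns, hse⟩ := h
  obtain ⟨N, t, ht⟩ := exists_common_tail hse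
  obtain ⟨Y₀, hY₀⟩ := hD.1
  obtain ⟨Y, hY, -, hsY⟩ := hD.exists_subset_hull hY₀ s.finite_toSet
  obtain ⟨X', hX', hXX', hYX'⟩ := hC.exists_subset_hull hX (hD.2.1 Y hY)
  obtain ⟨k, hk⟩ := exists_pow_smul_mem_of_subset_hull hp s.finite_toSet hsY
  obtain ⟨l, hl⟩ := exists_pow_smul_mem_of_subset_hull hp (hD.2.1 Y hY) hYX'
  have hYdec := hD.2.2.1 Y hY
  have hXdec := hC.2.2.1 X' hX'
  obtain ⟨Y, rfl⟩ := (hD.2.1 Y hY).exists_finset_coe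
  obtain ⟨X', rfl⟩ := (hC.2.1 X' hX').exists_finset_coe
  have hsX' : s ⊆ X' := by exact_mod_cast hsX.trans hXX'
  have ha : ∀ x : s, ∃ a : M → R, ∑ y ∈ Y, a y • y = p ^ (k + t x) • (x : M) := by
    intro x
    have : p ^ (k + t x) • (x : M) ∈ Submodule.span R (Y : Set M) := by
      rw [add_comm, pow_add, mul_smul]
      exact Submodule.smul_mem _ _ (hk x x.2)
    obtain ⟨a, -, ha⟩ := Submodule.mem_span_finset.1 this
    exact ⟨a, ha⟩
  choose a ha using ha
  have hb : ∀ y : M, ∃ b : M → R, y ∈ Y → ∑ x ∈ X', b x • x = p ^ l • y := by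
    intro y
    by_cases hy : y ∈ Y
    · obtain ⟨b, -, hb⟩ := Submodule.mem_span_finset.1 (hl y hy)
      exact ⟨b, fun _ => hb⟩
    · exact ⟨0, fun h => absurd h hy⟩
  choose b hb using hb
  have hcoeff : ∀ x x' : s, ∑ y ∈ Y, a x y * b y x' =
      if x = x' then p ^ (k + l + t x') else 0 := by
    intro x x'
    have hsum : ∑ z ∈ X', (∑ y ∈ Y, a x y * b y z - if (x : M) = z then p ^ (k + l + t x) else 0)
        • z = 0 := by
      simp only [sub_smul, Finset.sum_sub_distrib, Finset.sum_smul, ite_smul, zero_smul,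
        Finset.sum_ite_eq, hsX' x.2, if_true]
      rw [Finset.sum_comm, sub_eq_zero]
      calc ∑ y ∈ Y, ∑ z ∈ X', (a x y * b y z) • z = ∑ y ∈ Y, p ^ l • (a x y • y) := by
            refine Finset.sum_congr rfl fun y hy => ?_
            rw [smul_comm, ← hb y hy, Finset.smul_sum]
            simp only [mul_smul]
        _ = p ^ (k + l + t x) • (x : M) := by
            rw [← Finset.smul_sum, ha, ← mul_smul, ← pow_add]
            congr 2; ring
    have hli : LinearIndepOn R id (X' : Set M) := hXdec.1
    have := linearIndepOn_finset_iff.1 hli _ hsum x' (hsX' x'.2)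
    rw [sub_eq_zero] at this
    rw [this]
    by_cases hxx : x = x'
    · simp [hxx]
    · simp [hxx]
  have hdvd : ∀ x x' : s, ∀ y ∈ Y, ¬ UlmEquiv (UlmSeqOf p y) e →
      p ^ (k + l + t x' + 1) ∣ a x y * b y x' := by
    intro x x' y hy hye
    refine pow_dvd_mul_of_not_ulmEquiv hp he (ht x x.2) (ht x' x'.2) (fun i => ?_)
      (fun i => ?_) hye
    · have := hYdec.pheight_pow_smul_sum_le subset_rfl (a x) hy i
      rwa [ha, ← mul_smul, ← pow_add, ← add_assoc] at this
    · have := hXdec.pheight_pow_smul_sum_le subset_rfl (b y) (hsX' x'.2) i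
      rwa [hb y hy, ← mul_smul, ← pow_add] at this
  have hE : ∀ x x' : s, ∃ c : R, ∑ y ∈ Y with ¬ UlmEquiv (UlmSeqOf p y) e, a x y * b y x' =
      p ^ (k + l + t x' + 1) * c := fun x x' =>
    Finset.dvd_sum fun y hy => hdvd x x' y (Finset.mem_filter.1 hy).1 (Finset.mem_filter.1 hy).2
  choose E hE using hE
  set Ye := Y.filter fun y => UlmEquiv (UlmSeqOf p y) e
  let A : Matrix s Ye R := fun x y => a x y
  let B : Matrix Ye s R := fun y x' => b y x'
  have hAB : A * B = (1 - p • Matrix.of E) * Matrix.diagonal fun x' : s => p ^ (k + l + t x') := by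
    ext x x'
    have h1 : (A * B) x x' = ∑ y ∈ Ye, a x y * b y x' := by
      rw [Matrix.mul_apply]
      exact Finset.sum_coe_sort Ye fun y => a x y * b y x'
    have h2 := Finset.sum_filter_add_sum_filter_not Y (fun y => UlmEquiv (UlmSeqOf p y) e)
      fun y => a x y * b y x'
    rw [hE, hcoeff] at h2
    rw [h1, eq_sub_of_add_eq h2, Matrix.mul_diagonal]
    by_cases hxx : x = x' <;> simp [hxx] <;> ring
  have hcard := card_le_of_det_mul_ne_zero A B (by
    rw [hAB, Matrix.det_mul, Matrix.det_diagonal]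
    exact mul_ne_zero (det_one_sub_smul_ne_zero hp.not_isUnit _)
      (Finset.prod_ne_zero_iff.2 fun _ _ => pow_ne_zero _ hp.ne_zero))
  rw [Fintype.card_coe, Fintype.card_coe] at hcard
  exact ⟨Y, hY, Ye, by exact_mod_cast Finset.filter_subset _ _, hns.trans hcard,
    fun y hy => (Finset.mem_filter.1 hy).2⟩

end Invariance

theorem wHat_le_wHat {R : Type*} [CommRing R] {M N : Type u} [AddCommGroup M] [Module R M]
    [AddCommGroup N] [Module R N] {p : R} {C : Set (Set M)} {D : Set (Set N)}
    {e : ℕ → WithTop Ordinal.{u}}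
    (h : ∀ n, ∀ X ∈ C, HasAtLeast p e n X → ∃ Y ∈ D, HasAtLeast p e n Y) :
    wHat p C e ≤ wHat p D e := by
  refine sSup_le_sSup ?_
  rintro _ ⟨n, rfl, X, hX, hn⟩
  exact ⟨n, rfl, h n X hX hn⟩

theorem wHat_eq_of_isPDBWrt {R : Type*} [CommRing R] [IsDomain R] [IsDiscreteValuationRing R]
    {M : Type u} [AddCommGroup M] [Module R M] {p : R} (hp : Irreducible p)
    {C D : Set (Set M)} (hC : IsPDBWrt p C) (hD : IsPDBWrt p D)
    {e : ℕ → WithTop Ordinal.{u}} (he : IsUlmSeq e) : wHat p C e = wHat p D e :=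
  le_antisymm (wHat_le_wHat fun _ _ hX h => h.exists_of_isPDBWrt hp hC hD he hX)
    (wHat_le_wHat fun _ _ hX h => h.exists_of_isPDBWrt hp hD hC he hX)

section Transfer

variable {R : Type*} [CommRing R] {p : R} {M N : Type u} [AddCommGroup M] [Module R M]
  [AddCommGroup N] [Module R N] {I : Set (M →ₗ.[R] N)}

theorem IsPartialIsoSystem.mem_ppow_iff (hI : IsPartialIsoSystem I) (α : Ordinal.{u})
    {f : M →ₗ.[R] N} (hf : f ∈ I) (x : f.domain) : (x : M) ∈ ppow p α ↔ f x ∈ ppow p α := by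
  induction α using Ordinal.limitRecOn generalizing f with
  | zero => simp [ppow_zero]
  | add_one α ih =>
    rw [mem_ppow_add_one, mem_ppow_add_one]
    constructor
    · rintro ⟨z, hz, hzx⟩
      obtain ⟨g, hg, hfg, hzg⟩ := hI.2.2.1 f hf z
      refine ⟨g ⟨z, hzg⟩, (ih hg _).1 hz, ?_⟩
      rw [← g.map_smul]
      exact (hfg.2 hzx.symm).symm
    · rintro ⟨w, hw, hwx⟩
      obtain ⟨g, hg, hfg, z, rfl⟩ := hI.2.2.2 f hf w
      refine ⟨z, (ih hg z).2 hw, ?_⟩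
      rw [← g.map_smul, hfg.2 (y := ⟨x, hfg.1 x.2⟩) rfl] at hwx
      exact congrArg Subtype.val (hI.2.1 g hg hwx)
  | limit α hα ih =>
    rw [mem_ppow_of_isSuccLimit hα, mem_ppow_of_isSuccLimit hα]
    exact forall₂_congr fun β hβ => ih β hβ hf x

theorem IsPartialIsoSystem.pheight_apply (hI : IsPartialIsoSystem I) {f : M →ₗ.[R] N}
    (hf : f ∈ I) (x : f.domain) : pheight p (f x) = pheight p (x : M) :=
  pheight_congr fun α => (hI.mem_ppow_iff α hf x).symm

theorem IsPartialIsoSystem.ulmSeqOf_apply (hI : IsPartialIsoSystem I) {f : M →ₗ.[R] N}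
    (hf : f ∈ I) (x : f.domain) : UlmSeqOf p (f x) = UlmSeqOf p (x : M) := by
  funext i
  simp only [UlmSeqOf, ← f.map_smul]
  exact hI.pheight_apply hf _

theorem IsPartialIsoSystem.exists_subset_domain (hI : IsPartialIsoSystem I) {f : M →ₗ.[R] N}
    (hf : f ∈ I) {F : Set M} (hF : F.Finite) : ∃ g ∈ I, f ≤ g ∧ F ⊆ g.domain := by
  induction F, hF using Set.Finite.induction_on with
  | empty => exact ⟨f, hf, le_rfl, Set.empty_subset _⟩
  | @insert a F _ _ ih =>
    obtain ⟨g, hg, hfg, hFg⟩ := ih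
    obtain ⟨g', hg', hgg', hag'⟩ := hI.2.2.1 g hg a
    exact ⟨g', hg', hfg.trans hgg', Set.insert_subset hag' (hFg.trans hgg'.1)⟩

/-- The image of a set under a partially defined linear map. -/
def pimage (f : M →ₗ.[R] N) (X : Set M) : Set N :=
  f '' (Subtype.val ⁻¹' X)

theorem pimage_subset_of_le {f g : M →ₗ.[R] N} (hfg : f ≤ g) {X Y : Set M} (hXY : X ⊆ Y) :
    pimage f X ⊆ pimage g Y := by
  rintro _ ⟨x, hx, rfl⟩
  exact ⟨⟨x, hfg.1 x.2⟩, hXY hx, (hfg.2 rfl).symm⟩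

theorem apply_mem_span_pimage {f : M →ₗ.[R] N} {X : Set M} (hX : X ⊆ f.domain) {x : f.domain}
    (hx : (x : M) ∈ Submodule.span R X) : f x ∈ Submodule.span R (pimage f X) := by
  have h : Submodule.span R (Subtype.val ⁻¹' X : Set f.domain) =
      (Submodule.span R X).comap f.domain.subtype := by
    apply Submodule.map_injective_of_injective f.domain.injective_subtype
    rw [Submodule.map_span, Submodule.map_comap_subtype]
    have : f.domain.subtype '' (Subtype.val ⁻¹' X) = X := by
      exact Set.image_preimage_eq_of_subset (by simpa using hX)
    rw [this]
    exact (inf_eq_right.2 (Submodule.span_le.2 hX)).symm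
  have hx' : x ∈ Submodule.span R (Subtype.val ⁻¹' X : Set f.domain) := by
    rw [h]; exact hx
  exact Submodule.map_span f.toFun _ ▸ Submodule.mem_map_of_mem hx'

theorem IsPartialIsoSystem.isDecompWrt_pimage (hI : IsPartialIsoSystem I) {f : M →ₗ.[R] N}
    (hf : f ∈ I) {X : Set M} (hX : IsDecompWrt p X) :
    IsDecompWrt p (pimage f X) := by
  classical
  have hinj := hI.2.1 f hf
  refine ⟨?_, ?_, ?_⟩
  · have h : LinearIndepOn R id (Subtype.val ⁻¹' X : Set f.domain) := by
      refine LinearIndependent.of_comp f.domain.subtype ?_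
      exact hX.1.comp (fun x : (Subtype.val ⁻¹' X : Set f.domain) => (⟨x.1.1, x.2⟩ : X))
        fun x y hxy => Subtype.ext (Subtype.ext (congrArg (fun z : X => (z : M)) hxy))
    exact (h.map_injOn f.toFun hinj.injOn).id_image
  · rintro _ ⟨x, hx, rfl⟩ a ha h0
    rw [← f.map_smul] at h0
    have : a • x = 0 := hinj (h0.trans f.map_zero.symm)
    exact hX.2.1 x hx a ha (congrArg Subtype.val this)
  · intro s hs c
    obtain ⟨s, hsX, rfl⟩ := Finset.subset_set_image_iff.1 hs
    let c' : M → R := Function.extend Subtype.val (fun x : f.domain => c (f x)) 0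
    have hc' : ∀ x : f.domain, c' x = c (f x) := fun x =>
      Subtype.val_injective.extend_apply _ _ x
    have h := hX.2.2 (s.map (Function.Embedding.subtype _)) (by
      intro y hy
      obtain ⟨x, hx, rfl⟩ := Finset.mem_map.1 hy
      exact hsX hx) c'
    rw [Finset.sum_map, Finset.inf_map] at h
    rw [Finset.sum_image (g := f) fun x _ y _ hxy => hinj hxy, Finset.inf_image]
    have hsum : ∑ x ∈ s, c (f x) • f x = f (∑ x ∈ s, c (f x) • x) := by
      change _ = f.toFun _
      simp only [map_sum, map_smul]
      rfl
    rw [hsum, hI.pheight_apply hf]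
    simp only [Function.Embedding.subtype_apply, hc'] at h
    rw [AddSubmonoidClass.coe_finsetSum]
    refine h.trans (Finset.inf_congr rfl fun x _ => ?_)
    simp only [Function.comp_apply, Function.Embedding.subtype_apply, hc', ← f.map_smul,
      hI.pheight_apply hf]
    rfl

/-- The transport of a family of subsets along a partial isomorphism system. -/
def transport (I : Set (M →ₗ.[R] N)) (C : Set (Set M)) : Set (Set N) :=
  {Y | ∃ f ∈ I, ∃ X ∈ C, X ⊆ f.domain ∧ pimage f X = Y}

theorem IsPartialIsoSystem.isPDBWrt_transport (hI : IsPartialIsoSystem I) {C : Set (Set M)}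
    (hC : IsPDBWrt p C) : IsPDBWrt p (transport I C) := by
  refine ⟨?_, ?_, ?_, ?_⟩
  · obtain ⟨f, hf⟩ := hI.1
    obtain ⟨X, hX⟩ := hC.1
    obtain ⟨g, hg, -, hXg⟩ := hI.exists_subset_domain hf (hC.2.1 X hX)
    exact ⟨_, g, hg, X, hX, hXg, rfl⟩
  · rintro _ ⟨f, hf, X, hX, hXf, rfl⟩
    exact ((hC.2.1 X hX).preimage Subtype.val_injective.injOn).image _
  · rintro _ ⟨f, hf, X, hX, hXf, rfl⟩
    exact hI.isDecompWrt_pimage hf (hC.2.2.1 X hX)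
  · rintro _ ⟨f, hf, X, hX, hXf, rfl⟩ y
    obtain ⟨g, hg, hfg, x, rfl⟩ := hI.2.2.2 f hf y
    obtain ⟨Z, hZ, hXZ, c, hc, hcx⟩ := hC.2.2.2 X hX x
    obtain ⟨g', hg', hgg', hZg'⟩ := hI.exists_subset_domain hg (hC.2.1 Z hZ)
    refine ⟨_, ⟨g', hg', Z, hZ, hZg', rfl⟩, pimage_subset_of_le (hfg.trans hgg') hXZ, c, hc, ?_⟩
    rw [hgg'.2 (y := ⟨x, hgg'.1 x.2⟩) rfl, ← g'.map_smul]
    exact apply_mem_span_pimage hZg' hcx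

theorem IsPartialIsoSystem.wHat_transport (hI : IsPartialIsoSystem I) {C : Set (Set M)}
    (hC : IsPDBWrt p C) (e : ℕ → WithTop Ordinal.{u}) :
    wHat p (transport I C) e = wHat p C e := by
  classical
  refine le_antisymm (wHat_le_wHat ?_) (wHat_le_wHat ?_)
  · rintro n _ ⟨f, hf, X, hX, hXf, rfl⟩ ⟨s, hs, hns, hse⟩
    obtain ⟨s, hsX, rfl⟩ := Finset.subset_set_image_iff.1 hs
    refine ⟨X, hX, s.map (Function.Embedding.subtype _), ?_, ?_, ?_⟩
    · intro y hy
      obtain ⟨x, hx, rfl⟩ := Finset.mem_map.1 hy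
      exact hsX hx
    · rw [Finset.card_map]
      exact hns.trans Finset.card_image_le
    · intro y hy
      obtain ⟨x, hx, rfl⟩ := Finset.mem_map.1 hy
      have := hse _ (Finset.mem_image_of_mem _ hx)
      rwa [hI.ulmSeqOf_apply hf] at this
  · rintro n X hX ⟨s, hs, hns, hse⟩
    obtain ⟨f, hf⟩ := hI.1
    obtain ⟨g, hg, -, hXg⟩ := hI.exists_subset_domain hf (hC.2.1 X hX)
    refine ⟨_, ⟨g, hg, X, hX, hXg, rfl⟩, s.attach.image fun x : s => g ⟨x, hXg (hs x.2)⟩, ?_, ?_, ?_⟩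
    · intro y hy
      obtain ⟨x, -, rfl⟩ := Finset.mem_image.1 hy
      exact ⟨_, hs x.2, rfl⟩
    · rwa [Finset.card_image_of_injective, Finset.card_attach]
      intro x y hxy
      exact Subtype.ext (Subtype.mk.inj (hI.2.1 g hg hxy))
    · intro y hy
      obtain ⟨x, -, rfl⟩ := Finset.mem_image.1 hy
      rw [hI.ulmSeqOf_apply hg]
      exact hse x x.2

end Transfer

instance isDiscreteValuationRing_Zp (p : ℤ) [hp : Fact (Prime p)] :
    IsDiscreteValuationRing (Zp p) :=
  IsLocalization.AtPrime.isDiscreteValuationRing_of_dedekind_domain ℤ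
    (P := Ideal.span {p}) (by simpa using hp.out.ne_zero) (Zp p)

theorem irreducible_Zp (p : ℤ) [hp : Fact (Prime p)] : Irreducible (p : Zp p) := by
  rw [IsDiscreteValuationRing.irreducible_iff_uniformizer,
    ← Localization.AtPrime.map_eq_maximalIdeal, Ideal.map_span]
  simp

end UlmW

theorem statement_5 (p : ℤ) [Fact (Prime p)] {G H : Type u} [AddCommGroup G]
    [Module (Zp p) G] [AddCommGroup H] [Module (Zp p) H]
    (C : Set (Set G)) (hC : IsPDBWrt (p : Zp p) C)
    (I : Set (G →ₗ.[Zp p] H)) (hI : IsPartialIsoSystem I) :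
    (∃ D : Set (Set H), IsPDBWrt (p : Zp p) D) ∧
    ∀ D : Set (Set H), IsPDBWrt (p : Zp p) D →
      ∀ e : ℕ → WithTop Ordinal.{u}, IsUlmSeq e →
        wHat (p : Zp p) D e = wHat (p : Zp p) C e := by
  have hD₀ := hI.isPDBWrt_transport hC
  refine ⟨⟨_, hD₀⟩, fun D hD e he => ?_⟩
  rw [wHat_eq_of_isPDBWrt (irreducible_Zp p) hD hD₀ he, hI.wHat_transport hC]

end
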